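/- Let G be a connected finite simple graph and k ≥ 2 an integer. Let S be a subset of V(G) such that α_G(S) ≤ k + κ_G(S) − 1. Then G has a tree with at most k leaves that covers S (i.e., S ⊆ V(T)). -/

import Mathlib

open SimpleGraph Set

variable {V : Type*}

/-- The independence number of `S` in `G`: the maximum cardinality of a subset of `S`
that is independent in `G`. -/
noncomputable def indepNumOn (G : SimpleGraph V) (S : Set V) : ℕ :=
  sSup {n | ∃ I : Set V, I ⊆ S ∧ I.Pairwise (fun a b => ¬ G.Adj a b) ∧ I.ncard = n}

/-- `I` is a maximum independent subset of `S` in `G`. -/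
def MaxIndepOn (G : SimpleGraph V) (S : Set V) (I : Set V) : Prop :=
  I ⊆ S ∧ I.Pairwise (fun a b => ¬ G.Adj a b) ∧ I.ncard = indepNumOn G S

/-- Two `x`–`y` walks are internally disjoint if they share only `x` and `y`. -/
def InternallyDisjoint (G : SimpleGraph V) {x y : V} (p q : G.Walk x y) : Prop :=
  ∀ v, v ∈ p.support → v ∈ q.support → v = x ∨ v = y

/-- Local connectivity `κ_G(x,y)`: maximum number of pairwise internally disjoint
`x`–`y` paths in `G`. -/
noncomputable def localConn (G : SimpleGraph V) (x y : V) : ℕ :=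
  sSup {n | ∃ P : Set (G.Path x y),
    P.Pairwise (fun p q => InternallyDisjoint G p.1 q.1) ∧ P.ncard = n}

/-- `κ_G(S)`: the minimum of local connectivities over distinct pairs in `S`,
`+∞` if `S` has at most one element. -/
noncomputable def setConn (G : SimpleGraph V) (S : Set V) : ℕ∞ :=
  ⨅ x ∈ S, ⨅ y ∈ S, ⨅ _ : x ≠ y, (localConn G x y : ℕ∞)

/-- Vertex connectivity `κ(G)`: the maximum `k` such that `G` has more than `k`
vertices and removing fewer than `k` vertices always leaves a connected graph. -/
noncomputable def vertexConn (G : SimpleGraph V) [Fintype V] : ℕ :=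
  sSup {k | k < Fintype.card V ∧ ∀ X : Finset V, X.card < k →
    (G.induce ((↑X : Set V)ᶜ)).Connected}

/-- The set of leaves (vertices of degree one) of a subgraph. -/
def subLeaves {G : SimpleGraph V} (T : G.Subgraph) : Set V :=
  {v | v ∈ T.verts ∧ (T.neighborSet v).ncard = 1}

/-- The set of branch vertices (vertices of degree at least three) of a subgraph. -/
def subBranches {G : SimpleGraph V} (T : G.Subgraph) : Set V :=
  {v | v ∈ T.verts ∧ 3 ≤ (T.neighborSet v).ncard}

section IndepNum

variable [Finite V] {G : SimpleGraph V}

theorem bddAbove_indep_ncard (G : SimpleGraph V) (S : Set V) :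
    BddAbove {n | ∃ I : Set V, I ⊆ S ∧ I.Pairwise (fun a b => ¬ G.Adj a b) ∧ I.ncard = n} := by
  refine ⟨S.ncard, ?_⟩
  rintro _ ⟨I, hI, -, rfl⟩
  exact Set.ncard_le_ncard hI

theorem ncard_le_indepNumOn {S I : Set V} (hIS : I ⊆ S)
    (hI : I.Pairwise (fun a b => ¬ G.Adj a b)) : I.ncard ≤ indepNumOn G S :=
  le_csSup (bddAbove_indep_ncard G S) ⟨I, hIS, hI, rfl⟩

theorem exists_maxIndepOn (G : SimpleGraph V) (S : Set V) : ∃ I, MaxIndepOn G S I :=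
  Nat.sSup_mem (s := {n | ∃ I : Set V, I ⊆ S ∧ I.Pairwise (fun a b => ¬ G.Adj a b) ∧ I.ncard = n})
    ⟨0, ∅, by simp⟩ (bddAbove_indep_ncard G S)

theorem indepNumOn_mono {A B : Set V} (h : A ⊆ B) : indepNumOn G A ≤ indepNumOn G B := by
  obtain ⟨I, hIA, hI, hcard⟩ := exists_maxIndepOn G A
  exact hcard ▸ ncard_le_indepNumOn (hIA.trans h) hI

theorem indepNumOn_union_le (A B : Set V) :
    indepNumOn G (A ∪ B) ≤ indepNumOn G A + indepNumOn G B := by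
  obtain ⟨I, hIS, hI, hcard⟩ := exists_maxIndepOn G (A ∪ B)
  have h1 := ncard_le_indepNumOn (S := A) Set.inter_subset_right
    (hI.mono (Set.inter_subset_left (t := A)))
  have h2 := ncard_le_indepNumOn (S := B) Set.inter_subset_right
    (hI.mono (Set.inter_subset_left (t := B)))
  have h3 : I = I ∩ A ∪ I ∩ B := by
    rw [← Set.inter_union_distrib_left, Set.inter_eq_left.2 hIS]
  have h4 := Set.ncard_union_le (I ∩ A) (I ∩ B)
  rw [← h3] at h4
  lia

theorem indepNumOn_union {A B : Set V} (h : ∀ a ∈ A, ∀ b ∈ B, a ≠ b ∧ ¬ G.Adj a b) :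
    indepNumOn G (A ∪ B) = indepNumOn G A + indepNumOn G B := by
  refine le_antisymm (indepNumOn_union_le A B) ?_
  obtain ⟨I, hIA, hI, hIc⟩ := exists_maxIndepOn G A
  obtain ⟨J, hJB, hJ, hJc⟩ := exists_maxIndepOn G B
  have hdisj : Disjoint I J :=
    Set.disjoint_left.2 fun x hx hx' => (h x (hIA hx) x (hJB hx')).1 rfl
  rw [← hIc, ← hJc, ← Set.ncard_union_eq hdisj]
  refine ncard_le_indepNumOn (Set.union_subset_union hIA hJB) ?_
  refine Set.pairwise_union.2 ⟨hI, hJ, fun a ha b hb _ => ?_⟩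
  have := (h a (hIA ha) b (hJB hb)).2
  exact ⟨this, fun hba => this hba.symm⟩

theorem indepNumOn_pos {A : Set V} (h : A.Nonempty) : 0 < indepNumOn G A := by
  obtain ⟨a, ha⟩ := h
  have := ncard_le_indepNumOn (G := G) (S := A) (I := {a}) (by simpa) (by simp)
  rw [Set.ncard_singleton] at this
  lia

/-- `a` and `b` are joined by a walk all of whose inner vertices lie in `X`. -/
def Linked (G : SimpleGraph V) (X : Set V) (a b : V) : Prop :=
  ∃ x, Relation.ReflTransGen (fun u w => G.Adj u w ∧ w ∈ X) a x ∧ G.Adj x b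

theorem indepNumOn_modular {X K A B : Set V} (hK : K ⊆ X) (hB : Disjoint B X)
    (h : ∀ a ∈ A, ∀ b ∈ B, a ≠ b ∧ ¬ Linked G X a b) :
    indepNumOn G (K ∪ A ∪ B) + indepNumOn G K = indepNumOn G (K ∪ A) + indepNumOn G (K ∪ B) := by
  set Z : Set V := {x | ∃ a ∈ A, Relation.ReflTransGen (fun u w => G.Adj u w ∧ w ∈ X) a x} with hZ
  have hAZ : A ⊆ Z := fun a ha => ⟨a, ha, .refl⟩
  have hBZ : ∀ b ∈ B, b ∉ Z := by
    rintro b hb ⟨a, ha, hab⟩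
    rcases hab.cases_tail with rfl | ⟨c, -, -, hc⟩
    · exact (h _ ha _ hb).1 rfl
    · exact Set.disjoint_left.1 hB hb hc
  have split : ∀ W ⊆ K ∪ A ∪ B,
      indepNumOn G W = indepNumOn G (W ∩ Z) + indepNumOn G (W \ Z) := by
    intro W hW
    rw [← indepNumOn_union, Set.inter_union_sdiff]
    rintro x ⟨-, hx⟩ y ⟨hyW, hy⟩
    refine ⟨fun hxy => hy (hxy ▸ hx), fun hadj => ?_⟩
    obtain ⟨a, ha, hax⟩ := hx
    rcases hW hyW with (hyK | hyA) | hyB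
    · exact hy ⟨a, ha, hax.tail ⟨hadj, hK hyK⟩⟩
    · exact hy (hAZ hyA)
    · exact (h a ha y hyB).2 ⟨x, hax, hadj⟩
  have e1 : (K ∪ A ∪ B) ∩ Z = (K ∪ A) ∩ Z := by ext x; have := hBZ x; grind
  have e2 : (K ∪ A ∪ B) \ Z = (K ∪ B) \ Z := by ext x; have := @hAZ x; grind
  have e3 : (K ∪ B) ∩ Z = K ∩ Z := by ext x; have := hBZ x; grind
  have e4 : (K ∪ A) \ Z = K \ Z := by ext x; have := @hAZ x; grind
  rw [split (K ∪ A ∪ B) subset_rfl, split K (by grind), split (K ∪ A) (by grind),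
    split (K ∪ B) (by grind), e1, e2, e3, e4]
  lia

theorem indepNumOn_biUnion_of_not_linked {ι : Type*} [LinearOrder ι] {X K : Set V} {U : ι → Set V}
    (hK : K ⊆ X) (F : Finset ι) (hU : ∀ i ∈ F, Disjoint (U i) X)
    (h : ∀ i ∈ F, ∀ j ∈ F, i < j → ∀ a ∈ U i, ∀ b ∈ U j, a ≠ b ∧ ¬ Linked G X a b)
    (hlt : ∀ i ∈ F, indepNumOn G K < indepNumOn G (K ∪ U i)) :
    indepNumOn G K + F.card ≤ indepNumOn G (K ∪ ⋃ i ∈ F, U i) := by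
  induction F using Finset.induction_on_max with
  | empty => simp
  | insert i F hi ih =>
    have ih' := ih (fun j hj => hU j (by simp [hj]))
      (fun j hj j' hj' => h j (by simp [hj]) j' (by simp [hj'])) (fun j hj => hlt j (by simp [hj]))
    have hm := indepNumOn_modular (G := G) (A := ⋃ j ∈ F, U j) hK (hU i (by simp)) (by
      intro a ha b hb
      simp only [Set.mem_iUnion] at ha
      obtain ⟨j, hj, ha⟩ := ha
      exact h j (by simp [hj]) i (by simp) (hi j hj) a ha b hb)
    have e : K ∪ ⋃ j ∈ insert i F, U j = K ∪ (⋃ j ∈ F, U j) ∪ U i := by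
      rw [Finset.set_biUnion_insert, Set.union_comm (U i), Set.union_assoc]
    have := hlt i (by simp)
    rw [e, Finset.card_insert_of_notMem fun h => (hi i h).false]
    lia

end IndepNum

section PathLists

variable {G : SimpleGraph V}

theorem exists_walk_of_reflTransGen {X : Set V} {a b : V} (ha : a ∈ X)
    (h : Relation.ReflTransGen (fun u w => G.Adj u w ∧ w ∈ X) a b) :
    ∃ w : G.Walk a b, ∀ u ∈ w.support, u ∈ X := by
  induction h with
  | refl => exact ⟨.nil, by simpa⟩
  | tail _ hbc ih =>
    obtain ⟨w, hw⟩ := ih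
    refine ⟨w.concat hbc.1, fun u hu => ?_⟩
    rw [Walk.support_concat, List.mem_append] at hu
    rcases hu with hu | hu
    · exact hw u hu
    · rw [List.mem_singleton.1 hu]
      exact hbc.2

theorem exists_isChain_of_walk {X : Set V} {a b : V} (w : G.Walk a b)
    (hw : ∀ u ∈ w.support, u ∈ X) :
    ∃ Q : List V, Q.IsChain G.Adj ∧ Q.Nodup ∧ (∀ u ∈ Q, u ∈ X) ∧ Q.head? = some a ∧
      Q.getLast? = some b := by
  classical
  refine ⟨w.bypass.support, w.bypass.isChain_adj_support, w.bypass_isPath.support_nodup,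
    fun u hu => hw u (w.support_bypass_subset_support hu), ?_, ?_⟩
  · rw [List.head?_eq_some_head w.bypass.support_ne_nil, Walk.head_support]
  · rw [List.getLast?_eq_some_getLast w.bypass.support_ne_nil, Walk.getLast_support]

theorem exists_bridge {H : Set V} (hne : H.Nonempty)
    (hconn : ∀ a ∈ H, ∀ b ∈ H, ∃ w : G.Walk a b, ∀ u ∈ w.support, u ∈ H) {L₁ L₂ : List V}
    (h₁ : ∀ y ∈ L₁.getLast?, ∃ h ∈ H, G.Adj h y) (h₂ : ∀ y ∈ L₂.head?, ∃ h ∈ H, G.Adj h y) :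
    ∃ Q : List V, Q.IsChain G.Adj ∧ Q.Nodup ∧ (∀ u ∈ Q, u ∈ H) ∧ Q ≠ [] ∧
      (∀ x ∈ L₁.getLast?, ∀ y ∈ Q.head?, G.Adj x y) ∧
      ∀ x ∈ Q.getLast?, ∀ y ∈ L₂.head?, G.Adj x y := by
  have pick : ∀ o : Option V, (∀ y ∈ o, ∃ h ∈ H, G.Adj h y) → ∃ h ∈ H, ∀ y ∈ o, G.Adj h y := by
    rintro (_ | y) ho
    · exact ⟨hne.some, hne.some_mem, by simp⟩
    · simpa using ho
  obtain ⟨a, ha, ha'⟩ := pick _ h₁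
  obtain ⟨b, hb, hb'⟩ := pick _ h₂
  obtain ⟨w, hw⟩ := hconn a ha b hb
  obtain ⟨Q, hQ, hQn, hQH, hhead, hlast⟩ := exists_isChain_of_walk w hw
  refine ⟨Q, hQ, hQn, hQH, by rintro rfl; simp at hhead, ?_, ?_⟩
  · simpa [hhead] using fun x hx => (ha' x hx).symm
  · simpa [hlast] using hb'

theorem Linked.exists_isChain {X : Set V} {a b : V} (h : Linked G X a b) :
    ∃ Q : List V, Q.IsChain G.Adj ∧ Q.Nodup ∧ (∀ u ∈ Q, u ∈ X) ∧ (a :: Q ++ [b]).IsChain G.Adj := by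
  obtain ⟨x, hax, hxb⟩ := h
  rcases hax.cases_head with rfl | ⟨c, ⟨hac, hc⟩, hcx⟩
  · exact ⟨[], by simp, by simp, by simp, by simpa⟩
  · obtain ⟨w, hw⟩ := exists_walk_of_reflTransGen hc hcx
    obtain ⟨Q, hQ, hQn, hQX, hhead, hlast⟩ := exists_isChain_of_walk w hw
    refine ⟨Q, hQ, hQn, hQX, ?_⟩
    rw [List.isChain_append, List.isChain_cons]
    refine ⟨⟨by simpa [hhead], hQ⟩, by simp, ?_⟩
    rw [List.getLast?_cons]
    simpa [hlast]

end PathLists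

section Trees

variable {G : SimpleGraph V}

/-- The vertices of degree at most one in a subgraph. -/
def subEnds (T : G.Subgraph) : Set V :=
  {v | v ∈ T.verts ∧ (T.neighborSet v).ncard ≤ 1}

/-- A subgraph which is connected and acyclic. -/
def IsSubtree (T : G.Subgraph) : Prop :=
  T.Connected ∧ T.spanningCoe.IsAcyclic

theorem IsSubtree.isTree {T : G.Subgraph} (hT : IsSubtree T) : T.coe.IsTree := by
  refine ⟨hT.1.coe, hT.2.comap ⟨Subtype.val, fun {a b} h => ?_⟩ Subtype.val_injective⟩
  simpa using h

theorem isSubtree_singletonSubgraph (v : V) : IsSubtree (G.singletonSubgraph v) := by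
  refine ⟨Subgraph.singletonSubgraph_connected, ?_⟩
  convert isAcyclic_bot
  ext a b
  simp

variable [Finite V]

theorem IsSubtree.sup_subgraphOfAdj {T : G.Subgraph} (hT : IsSubtree T) {a b : V}
    (hab : G.Adj a b) (ha : a ∈ T.verts) (hb : b ∉ T.verts) :
    IsSubtree (T ⊔ G.subgraphOfAdj hab) ∧ (T ⊔ G.subgraphOfAdj hab).verts = insert b T.verts ∧
      b ∈ subEnds (T ⊔ G.subgraphOfAdj hab) ∧
      subEnds (T ⊔ G.subgraphOfAdj hab) ⊆ insert b (subEnds T) ∧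
      ((T.neighborSet a).Nonempty → subEnds (T ⊔ G.subgraphOfAdj hab) ⊆
        insert b (subEnds T \ {a})) := by
  have hverts : (T ⊔ G.subgraphOfAdj hab).verts = insert b T.verts := by
    ext x; simp; grind
  have hnb : T.neighborSet b = ∅ := by
    ext x; simp only [Subgraph.mem_neighborSet, Set.mem_empty_iff_false, iff_false]
    exact fun h => hb h.fst_mem
  have hsub : subEnds (T ⊔ G.subgraphOfAdj hab) ⊆ insert b (subEnds T) := by
    rintro x ⟨hx, hx1⟩
    rw [hverts] at hx
    rcases hx with rfl | hx
    · exact Set.mem_insert _ _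
    · refine Or.inr ⟨hx, le_trans (Set.ncard_le_ncard ?_) hx1⟩
      rw [Subgraph.neighborSet_sup]
      exact Set.subset_union_left
  refine ⟨⟨?_, ?_⟩, hverts, ⟨by rw [hverts]; simp, ?_⟩, hsub, ?_⟩
  · exact Subgraph.connected_sup hT.1.preconnected
      (Subgraph.subgraphOfAdj_connected hab).preconnected ⟨a, by simp [ha]⟩
  · have hnr : ¬ T.spanningCoe.Reachable a b := by
      rintro ⟨w⟩
      cases w.reverse with
      | nil => exact hb ha
      | cons h _ => exact hb (T.edge_vert h)
    convert (isAcyclic_add_edge_iff_of_not_reachable a b hnr).2 hT.2 using 1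
    ext x y
    simp [SimpleGraph.edge_adj]
  · rw [Subgraph.neighborSet_sup, hnb, Set.empty_union]
    refine le_trans (Set.ncard_le_ncard (t := {a}) ?_) (by simp)
    intro x; simp
  · rintro ⟨c, hc⟩ x hx
    rcases hsub hx with rfl | hxT
    · exact Set.mem_insert _ _
    · refine Or.inr ⟨hxT, ?_⟩
      rintro rfl
      have h2 := hx.2
      have hcb : c ≠ b := by rintro rfl; exact hb (T.edge_vert hc.symm)
      have : ({c, b} : Set V).ncard ≤ 1 := le_trans (Set.ncard_le_ncard (by
        rw [Subgraph.neighborSet_sup]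
        rintro y (rfl | rfl)
        · exact Or.inl hc
        · exact Or.inr (by simp))) h2
      rw [Set.ncard_pair hcb] at this
      lia

theorem IsSubtree.exists_extend (Q : List V) {T : G.Subgraph} (hT : IsSubtree T) {a b : V}
    (ha : a ∈ T.verts) (hQ : (a :: b :: Q).IsChain G.Adj) (hn : (b :: Q).Nodup)
    (hd : ∀ u ∈ b :: Q, u ∉ T.verts) :
    ∃ T' : G.Subgraph, IsSubtree T' ∧ T'.verts = T.verts ∪ {u | u ∈ b :: Q} ∧
      subEnds T' ⊆ insert ((b :: Q).getLast (by simp)) (subEnds T) ∧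
      ((T.neighborSet a).Nonempty →
        subEnds T' ⊆ insert ((b :: Q).getLast (by simp)) (subEnds T \ {a})) := by
  induction Q generalizing T a b with
  | nil =>
    have hab : G.Adj a b := by simpa using hQ
    obtain ⟨h1, h2, -, h3, h4⟩ := hT.sup_subgraphOfAdj hab ha (hd b (by simp))
    refine ⟨_, h1, ?_, h3, h4⟩
    rw [h2]; ext; simp
  | cons c Q ih =>
    rw [List.isChain_cons_cons] at hQ
    have hbT := hd b (by simp)
    obtain ⟨h1, h2, -, h3, h4⟩ := hT.sup_subgraphOfAdj hQ.1 ha hbT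
    obtain ⟨T', hT', hv, -, he⟩ := ih h1 (a := b) (b := c) (by rw [h2]; simp) hQ.2
      (List.nodup_cons.1 hn).2 (by
        rw [h2]
        rintro u hu (rfl | hu')
        · exact (List.nodup_cons.1 hn).1 hu
        · exact hd u (List.mem_cons_of_mem _ hu) hu')
    have he' := he ⟨a, by simp⟩
    have hbE : b ∉ subEnds T := fun h => hbT h.1
    refine ⟨T', hT', ?_, ?_, fun hne => ?_⟩
    · rw [hv, h2]; ext; simp; grind
    · rw [List.getLast_cons (by simp)]
      intro x hx
      have := he' hx
      have := @h3 x
      grind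
    · rw [List.getLast_cons (by simp)]
      intro x hx
      have := he' hx
      have := @h4 hne x
      grind

theorem exists_isSubtree_of_isChain {l : List V} (hl : l ≠ []) (hc : l.IsChain G.Adj)
    (hn : l.Nodup) : ∃ T : G.Subgraph, IsSubtree T ∧ (∀ u ∈ l, u ∈ T.verts) ∧
      T.verts = {u | u ∈ l} ∧ (subEnds T).ncard ≤ 2 := by
  obtain _ | ⟨a, _ | ⟨b, Q⟩⟩ := l
  · exact absurd rfl hl
  · refine ⟨_, isSubtree_singletonSubgraph a, by simp, by ext; simp, ?_⟩
    refine le_trans (Set.ncard_le_ncard (t := {a}) fun x hx => by simpa using hx.1) (by simp)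
  · obtain ⟨T, hT, hv, he, -⟩ := (isSubtree_singletonSubgraph a).exists_extend Q (by simp) hc
      (List.nodup_cons.1 hn).2 (by
        rintro u hu hu'
        rw [Set.mem_singleton_iff.1 hu'] at hu
        exact (List.nodup_cons.1 hn).1 hu)
    have hv' : T.verts = {u | u ∈ a :: b :: Q} := by rw [hv]; ext; simp
    refine ⟨T, hT, by rw [hv']; simp, hv', ?_⟩
    refine le_trans (Set.ncard_le_ncard (t := {(b :: Q).getLast (by simp), a}) ?_)
      ((Set.ncard_insert_le _ _).trans (by simp))
    intro x hx
    rcases he hx with h | h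
    · exact Or.inl h
    · exact Or.inr h.1

end Trees

section Cover

variable {G : SimpleGraph V}

theorem exists_walk_avoiding {T : Set V} {x v : V} (p : G.Walk x v) (hv : v ∉ T) :
    (∀ u ∈ p.support, u ∈ Tᶜ) ∨
      ∃ a ∈ T, ∃ c, G.Adj a c ∧ ∃ w : G.Walk c v, ∀ u ∈ w.support, u ∈ Tᶜ := by
  induction p with
  | nil => left; simpa
  | @cons x c v h p ih =>
    rcases ih hv with ih | ih
    · by_cases hx : x ∈ T
      · exact Or.inr ⟨x, hx, c, h, p, ih⟩
      · left
        simpa [hx] using ih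
    · exact Or.inr ih

/-- `L` is the list of vertices after `a` of a path that starts at `a ∈ T`, runs outside `T`
and ends in `S`. -/
structure IsEar (G : SimpleGraph V) (S T : Set V) (a : V) (L : List V) : Prop where
  mem : a ∈ T
  isChain : (a :: L).IsChain G.Adj
  nodup : L.Nodup
  notMem : ∀ u ∈ L, u ∉ T
  getLast_mem : ∃ q ∈ S, L.getLast? = some q

theorem exists_isEar (hG : G.Connected) {S T : Set V} (hT : T.Nonempty) {v : V} (hv : v ∈ S)
    (hvT : v ∉ T) : ∃ a L, IsEar G S T a L := by
  obtain ⟨x, hx⟩ := hT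
  obtain ⟨p⟩ := hG.preconnected x v
  rcases exists_walk_avoiding p hvT with h | ⟨a, ha, c, hac, w, hw⟩
  · exact absurd hx (h x p.start_mem_support)
  · obtain ⟨Q, hQ, hQn, hQX, hhead, hlast⟩ := exists_isChain_of_walk w hw
    refine ⟨a, Q, ha, ?_, hQn, hQX, v, hv, hlast⟩
    rw [List.isChain_cons]
    exact ⟨by simpa [hhead], hQ⟩

variable [Finite V]

theorem exists_maximal_isEar (hG : G.Connected) {S T : Set V} (hT : T.Nonempty)
    (h : (S \ T).Nonempty) : ∃ a L q, IsEar G S T a L ∧ L.getLast? = some q ∧ q ∈ S ∧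
      ∀ w ∈ S, w ∉ T → w ∉ L → ¬ G.Adj q w := by
  obtain ⟨v, hv, hvT⟩ := h
  obtain ⟨a₀, L₀, h₀⟩ := exists_isEar hG hT hv hvT
  have hb : BddAbove {n | ∃ a L, IsEar G S T a L ∧ (S ∩ {u | u ∈ L}).ncard = n} := by
    refine ⟨S.ncard, ?_⟩
    rintro _ ⟨a, L, -, rfl⟩
    exact Set.ncard_le_ncard Set.inter_subset_left
  have hne : {n | ∃ a L, IsEar G S T a L ∧ (S ∩ {u | u ∈ L}).ncard = n}.Nonempty :=
    ⟨_, a₀, L₀, h₀, rfl⟩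
  obtain ⟨a, L, hL, hmax⟩ := Nat.sSup_mem hne hb
  obtain ⟨q, hq, hlast⟩ := hL.getLast_mem
  refine ⟨a, L, q, hL, hlast, hq, fun w hw hwT hwL hadj => ?_⟩
  have hL' : IsEar G S T a (L ++ [w]) := by
    refine ⟨hL.mem, ?_, ?_, ?_, w, hw, by simp⟩
    · rw [← List.cons_append, List.isChain_append]
      refine ⟨hL.isChain, by simp, ?_⟩
      rw [List.getLast?_cons]
      simpa [hlast]
    · simpa [List.nodup_append, hL.nodup] using fun x hx (e : x = w) => hwL (e ▸ hx)
    · intro u hu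
      rcases List.mem_append.1 hu with hu | hu
      · exact hL.notMem u hu
      · rwa [List.mem_singleton.1 hu]
  have h1 := le_csSup hb ⟨a, _, hL', rfl⟩
  rw [← hmax] at h1
  refine absurd h1 (not_le.2 (Set.ncard_lt_ncard ?_))
  refine (Set.ssubset_iff_of_subset fun x hx => ?_).2 ⟨w, ⟨hw, by simp⟩, fun h => hwL h.2⟩
  exact ⟨hx.1, List.mem_append_left _ hx.2⟩

theorem IsSubtree.exists_cover (hG : G.Connected) (S : Set V) {T : G.Subgraph}
    (hT : IsSubtree T) : ∃ T' : G.Subgraph, IsSubtree T' ∧ S ⊆ T'.verts ∧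
      (subEnds T').ncard ≤ (subEnds T).ncard + indepNumOn G (S \ T.verts) := by
  induction hm : (S \ T.verts).ncard using Nat.strong_induction_on generalizing T with
  | _ m ih =>
    subst hm
    rcases (S \ T.verts).eq_empty_or_nonempty with h | h
    · exact ⟨T, hT, Set.sdiff_eq_empty.1 h, Nat.le_add_right _ _⟩
    obtain ⟨a, L, q, hL, hlast, hq, hadj⟩ := exists_maximal_isEar hG hT.1.nonempty h
    obtain _ | ⟨b, Q⟩ := L
    · simp at hlast
    obtain ⟨T₁, hT₁, hv, he, -⟩ := hT.exists_extend Q hL.mem hL.isChain hL.nodup hL.notMem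
    have hqL : q ∈ b :: Q := List.mem_of_getLast? hlast
    have hqT := hL.notMem q hqL
    have hsub : S \ T₁.verts ⊆ S \ T.verts := by
      rw [hv]
      exact fun x hx => ⟨hx.1, fun h => hx.2 (Or.inl h)⟩
    obtain ⟨T', hT', hS, hcard⟩ := ih _ (Set.ncard_lt_ncard
      ((Set.ssubset_iff_of_subset hsub).2 ⟨q, ⟨hq, hqT⟩, fun h => h.2 (hv ▸ Or.inr hqL)⟩)) hT₁ rfl
    refine ⟨T', hT', hS, hcard.trans ?_⟩
    have h1 : (subEnds T₁).ncard ≤ (subEnds T).ncard + 1 :=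
      (Set.ncard_le_ncard he).trans (Set.ncard_insert_le _ _)
    have h2 : indepNumOn G (S \ T₁.verts ∪ {q}) =
        indepNumOn G (S \ T₁.verts) + indepNumOn G {q} := by
      refine indepNumOn_union ?_
      rintro w ⟨hw, hwT⟩ _ rfl
      rw [hv] at hwT
      refine ⟨fun e => hwT (Or.inr (e ▸ hqL)), fun h => ?_⟩
      exact hadj w hw (fun h => hwT (Or.inl h)) (fun h => hwT (Or.inr h)) h.symm
    have h3 : indepNumOn G (S \ T₁.verts ∪ {q}) ≤ indepNumOn G (S \ T.verts) :=
      indepNumOn_mono (Set.union_subset hsub (by simp [hq, hqT]))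
    have h4 := indepNumOn_pos (G := G) (Set.singleton_nonempty q)
    lia

end Cover

section Absorption

variable {G : SimpleGraph V}

/-- `l` is a path and `H` a component of its complement such that rerouting `l` through `H`
always costs independence outside `H`, as long as no neighbour of `H` is dropped. -/
structure IsStuck (G : SimpleGraph V) (S : Set V) (l : List V) (H : Set V) : Prop where
  isChain : l.IsChain G.Adj
  nodup : l.Nodup
  notMem : ∀ h ∈ H, h ∉ l
  closed : ∀ h ∈ H, ∀ w, G.Adj h w → w ∉ l → w ∈ H
  connected : ∀ a ∈ H, ∀ b ∈ H, ∃ w : G.Walk a b, ∀ u ∈ w.support, u ∈ H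
  nonempty : H.Nonempty
  absorb : ∀ l' : List V, l'.IsChain G.Adj → l'.Nodup → (∃ h ∈ H, h ∈ l') →
    (∀ y ∈ l, y ∉ l' → ¬ ∃ h ∈ H, G.Adj h y) →
    indepNumOn G (S \ ({u | u ∈ l} ∪ H)) < indepNumOn G ((S \ {u | u ∈ l'}) \ H)

variable [Finite V] {S H : Set V} {l : List V}

theorem IsStuck.lt_of_drop (hs : IsStuck G S l H) {L₁ A L₂ : List V} (hl : l = L₁ ++ A ++ L₂)
    (h₁ : ∀ y ∈ L₁.getLast?, ∃ h ∈ H, G.Adj h y) (h₂ : ∀ y ∈ L₂.head?, ∃ h ∈ H, G.Adj h y)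
    (hA : ∀ y ∈ A, ¬ ∃ h ∈ H, G.Adj h y) :
    indepNumOn G (S \ ({u | u ∈ l} ∪ H)) <
      indepNumOn G (S \ ({u | u ∈ l} ∪ H) ∪ S ∩ {u | u ∈ A}) := by
  obtain ⟨Q, hQ, hQn, hQH, hne, e₁, e₂⟩ := exists_bridge hs.nonempty hs.connected h₁ h₂
  have hc := hs.isChain
  have hn := hs.nodup
  have hd := hs.notMem
  rw [hl] at hc hn
  refine (hs.absorb (L₁ ++ (Q ++ L₂)) ?_ ?_ ?_ ?_).trans_le (indepNumOn_mono ?_)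
  · rw [List.isChain_append, List.isChain_append]
    refine ⟨hc.left_of_append.left_of_append, ⟨hQ, hc.right_of_append, e₂⟩, ?_⟩
    rwa [List.head?_append_of_ne_nil _ hne]
  · simp only [List.nodup_append, List.mem_append] at hn ⊢
    have hd' : ∀ u ∈ Q, u ∉ L₁ ∧ u ∉ L₂ := fun u hu => by
      have := hd u (hQH u hu)
      simp only [hl, List.mem_append] at this
      tauto
    grind
  · obtain ⟨q, hq⟩ := List.exists_mem_of_ne_nil Q hne
    exact ⟨q, hQH q hq, by simp [hq]⟩
  · intro y hy hy'
    refine hA y ?_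
    simp only [hl, List.mem_append] at hy hy'
    tauto
  · rintro x ⟨⟨hxS, hx⟩, hxH⟩
    simp only [hl, List.mem_append, Set.mem_ofPred_eq, Set.mem_union, Set.mem_inter_iff,
      Set.mem_sdiff] at hx ⊢
    tauto

theorem IsStuck.lt_of_cross (hs : IsStuck G S l H) {L₁ A M B L₂ : List V} {b b' : V}
    (hl : l = L₁ ++ A ++ b :: M ++ B ++ b' :: L₂)
    (h₁ : ∀ y ∈ L₁.getLast?, ∃ h ∈ H, G.Adj h y)
    (h₂ : ∀ y ∈ (b :: M).getLast?, ∃ h ∈ H, G.Adj h y)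
    (hA : ∀ y ∈ A, ¬ ∃ h ∈ H, G.Adj h y) (hB : ∀ y ∈ B, ¬ ∃ h ∈ H, G.Adj h y)
    (hb : Linked G ({u | u ∈ l} ∪ H)ᶜ b b') :
    indepNumOn G (S \ ({u | u ∈ l} ∪ H)) <
      indepNumOn G (S \ ({u | u ∈ l} ∪ H) ∪ S ∩ {u | u ∈ A} ∪ S ∩ {u | u ∈ B}) := by
  have hrev : (b :: M).reverse = M.reverse ++ [b] := by simp
  obtain ⟨Q', -, hQn', hQX, hbQ⟩ := hb.exists_isChain
  obtain ⟨Q, hQ, hQn, hQH, hne, e₁, e₂⟩ := exists_bridge (L₂ := (b :: M).reverse)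
    hs.nonempty hs.connected h₁ (by rwa [List.head?_reverse])
  have hc := hs.isChain
  have hn := hs.nodup
  have hd := hs.notMem
  rw [hl] at hc hn
  have hM : ((b :: M).reverse).IsChain G.Adj := by
    rw [List.isChain_reverse]
    exact (hc.left_of_append.left_of_append.right_of_append).imp fun _ _ h => h.symm
  refine (hs.absorb (L₁ ++ (Q ++ ((b :: M).reverse ++ (Q' ++ b' :: L₂)))) ?_ ?_ ?_ ?_).trans_le
    (indepNumOn_mono ?_)
  · rw [List.isChain_append, List.isChain_append]
    refine ⟨hc.left_of_append.left_of_append.left_of_append.left_of_append, ⟨hQ, ?_, ?_⟩, ?_⟩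
    · rw [hrev, List.append_assoc, List.singleton_append]
      refine List.isChain_split.2 ⟨hrev ▸ hM, ?_⟩
      rw [← List.cons_append]
      exact List.isChain_split.2 ⟨hbQ, hc.right_of_append⟩
    · rwa [List.head?_append_of_ne_nil _ (by simp)]
    · rwa [List.head?_append_of_ne_nil _ hne]
  · simp only [List.nodup_append, List.mem_append, List.nodup_reverse, List.mem_reverse] at hn ⊢
    have hd' : ∀ u ∈ Q, u ∉ L₁ ∧ u ∉ b :: M ∧ u ∉ b' :: L₂ := fun u hu => by
      have := hd u (hQH u hu)
      simp only [hl, List.mem_append] at this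
      tauto
    have hd'' : ∀ u ∈ Q', u ∉ L₁ ∧ u ∉ b :: M ∧ u ∉ b' :: L₂ ∧ u ∉ Q := fun u hu => by
      have := hQX u hu
      have hQu := hQH u
      simp only [hl, List.mem_append, Set.mem_compl_iff, Set.mem_union, Set.mem_ofPred_eq] at this
      tauto
    obtain ⟨⟨⟨⟨n1, -, -⟩, n2, d2⟩, -, -⟩, n3, d3⟩ := hn
    refine ⟨n1, ⟨hQn, ⟨n2, ⟨hQn', n3, ?_⟩, ?_⟩, ?_⟩, ?_⟩
    · rintro u hu _ hu' rfl
      exact (hd'' u hu).2.2.1 hu'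
    · rintro u hu _ (hu' | hu') rfl
      · exact (hd'' u hu').2.1 hu
      · exact d3 u (Or.inl (Or.inr hu)) u hu' rfl
    · rintro u hu _ (hu' | hu' | hu') rfl
      · exact (hd' u hu).2.1 hu'
      · exact (hd'' u hu').2.2.2 hu
      · exact (hd' u hu).2.2 hu'
    · rintro u hu _ (hu' | hu' | hu' | hu') rfl
      · exact (hd' u hu').1 hu
      · exact d2 u (Or.inl hu) u hu' rfl
      · exact (hd'' u hu').1 hu
      · exact d3 u (Or.inl (Or.inl (Or.inl hu))) u hu' rfl
  · obtain ⟨q, hq⟩ := List.exists_mem_of_ne_nil Q hne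
    exact ⟨q, hQH q hq, by simp [hq]⟩
  · intro y hy hy'
    have : y ∈ A ∨ y ∈ B := by
      simp only [hl, List.mem_append, List.mem_reverse] at hy hy'
      tauto
    exact this.elim (hA y) (hB y)
  · rintro x ⟨⟨hxS, hx⟩, hxH⟩
    simp only [hl, List.mem_append, List.mem_reverse, Set.mem_ofPred_eq, Set.mem_union,
      Set.mem_inter_iff, Set.mem_sdiff] at hx ⊢
    tauto

end Absorption

section Segments

variable {α : Type*}

/-- The entries of `l` at the positions `i, …, j - 1`. -/
def slice (l : List α) (i j : ℕ) : List α := (l.take j).drop i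

theorem mem_slice {l : List α} {i j : ℕ} {x : α} :
    x ∈ slice l i j ↔ ∃ c, i ≤ c ∧ c < j ∧ l[c]? = some x := by
  rw [slice, List.mem_iff_getElem?]
  constructor
  · rintro ⟨c, hc⟩
    rw [List.getElem?_drop, List.getElem?_take] at hc
    split_ifs at hc with h
    exact ⟨i + c, by lia, h, hc⟩
  · rintro ⟨c, hic, hcj, hc⟩
    refine ⟨c - i, ?_⟩
    rw [List.getElem?_drop, List.getElem?_take, Nat.add_sub_cancel' hic, if_pos hcj, hc]

theorem take_append_slice (l : List α) {i j : ℕ} (h : i ≤ j) :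
    l.take i ++ slice l i j = l.take j := by
  conv_rhs => rw [← List.take_append_drop i (l.take j), List.take_take, min_eq_left h]
  rfl

end Segments

section Stops

variable {G : SimpleGraph V} {S H : Set V} {l : List V}

/-- `p` is the first position of `l`, or the position after a neighbour of `H`. -/
def IsStart (G : SimpleGraph V) (l : List V) (H : Set V) (p : ℕ) : Prop :=
  p = 0 ∨ ∃ q, p = q + 1 ∧ ∃ y, l[q]? = some y ∧ ∃ h ∈ H, G.Adj h y

theorem IsStart.le_length {p : ℕ} (hp : IsStart G l H p) : p ≤ l.length := by
  obtain rfl | ⟨q, rfl, y, hy, -⟩ := hp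
  · simp
  · obtain ⟨h, -⟩ := List.getElem?_eq_some_iff.1 hy
    lia

theorem IsStart.getLast?_take {p : ℕ} (hp : IsStart G l H p) :
    ∀ y ∈ (l.take p).getLast?, ∃ h ∈ H, G.Adj h y := by
  obtain rfl | ⟨q, rfl, y, hy, h⟩ := hp
  · simp
  · rw [List.getLast?_take]
    simpa [hy]

/-- `m` is the first position after `p` at which the segment of `l` beginning at `p` adds
to the independence number of the part of `S` outside `l` and `H`. -/
structure IsStop (G : SimpleGraph V) (S : Set V) (l : List V) (H : Set V) (p m : ℕ) : Prop where
  le : p ≤ m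
  lt : m < l.length
  not_adj : ∀ c, p ≤ c → c ≤ m → ∀ y, l[c]? = some y → ¬ ∃ h ∈ H, G.Adj h y
  indepNumOn_le : indepNumOn G (S \ ({u | u ∈ l} ∪ H) ∪ S ∩ {u | u ∈ slice l p m}) ≤
    indepNumOn G (S \ ({u | u ∈ l} ∪ H))
  lt_indepNumOn : indepNumOn G (S \ ({u | u ∈ l} ∪ H)) <
    indepNumOn G (S \ ({u | u ∈ l} ∪ H) ∪ S ∩ {u | u ∈ slice l p (m + 1)})

theorem IsStuck.exists_isStop [Finite V] (hs : IsStuck G S l H) {p : ℕ} (hp : IsStart G l H p) :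
    ∃ m, IsStop G S l H p m := by
  set D : ℕ → Prop := fun m => p ≤ m ∧ m ≤ l.length ∧
    (∀ c, p ≤ c → c < m → ∀ y, l[c]? = some y → ¬ ∃ h ∈ H, G.Adj h y) ∧
    indepNumOn G (S \ ({u | u ∈ l} ∪ H) ∪ S ∩ {u | u ∈ slice l p m}) ≤
      indepNumOn G (S \ ({u | u ∈ l} ∪ H)) with hD
  have hDp : D p := by
    refine ⟨le_rfl, hp.le_length, fun c h1 h2 => by lia, indepNumOn_mono ?_⟩
    refine Set.union_subset subset_rfl ?_
    rintro x ⟨-, hx⟩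
    obtain ⟨c, h1, h2, -⟩ := mem_slice.1 hx
    lia
  have hfin : {m | D m}.Finite := (Set.finite_Iic l.length).subset fun m hm => hm.2.1
  obtain ⟨m, hm, hmax⟩ := hfin.exists_maximal ⟨p, hDp⟩
  have hdrop : ¬ ∀ y ∈ (l.drop m).head?, ∃ h ∈ H, G.Adj h y := by
    intro h
    have hl : l = l.take p ++ slice l p m ++ l.drop m := by
      rw [take_append_slice l hm.1, List.take_append_drop]
    refine absurd (hs.lt_of_drop hl hp.getLast?_take h fun y hy => ?_) (not_lt.2 hm.2.2.2)
    obtain ⟨c, h1, h2, hc⟩ := mem_slice.1 hy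
    exact hm.2.2.1 c h1 h2 y hc
  rw [List.head?_drop] at hdrop
  push Not at hdrop
  obtain ⟨y, hy, hyH⟩ := hdrop
  have hlt : m < l.length := (List.getElem?_eq_some_iff.1 hy).1
  have hna : ∀ c, p ≤ c → c ≤ m → ∀ y, l[c]? = some y → ¬ ∃ h ∈ H, G.Adj h y := by
    intro c hpc hcm z hz
    rcases hcm.lt_or_eq with h | rfl
    · exact hm.2.2.1 c hpc h z hz
    · rw [Option.mem_def.1 hy, Option.some_inj] at hz
      subst hz
      rintro ⟨h, hh, hadj⟩
      exact hyH h hh hadj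
  refine ⟨m, hm.1, hlt, hna, hm.2.2.2, ?_⟩
  by_contra hcon
  have : D (m + 1) :=
    ⟨by have := hm.1; lia, hlt, fun c h1 h2 => hna c h1 (by lia), not_lt.1 hcon⟩
  have := hmax this (Nat.le_succ m)
  lia

theorem IsStop.lt_of_isStart {p p' m : ℕ} (hm : IsStop G S l H p m) (hp' : IsStart G l H p')
    (h : p < p') : m + 1 < p' := by
  obtain rfl | ⟨q, rfl, y, hy, hy'⟩ := hp'
  · lia
  · by_contra hcon
    exact hm.not_adj q (by lia) (by lia) y hy hy'

theorem IsStuck.not_linked [Finite V] (hs : IsStuck G S l H) {p p' m m' : ℕ} (hp : IsStart G l H p)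
    (hp' : IsStart G l H p') (hm : IsStop G S l H p m) (hm' : IsStop G S l H p' m') (hpp : p < p') :
    ∀ s, ∀ c c', c + c' = s → p ≤ c → c ≤ m → p' ≤ c' → c' ≤ m' → ∀ b b', l[c]? = some b →
      l[c']? = some b' → ¬ Linked G ({u | u ∈ l} ∪ H)ᶜ b b' := by
  intro s
  induction s using Nat.strong_induction_on with
  | _ s ih =>
    intro c c' hcs hpc hcm hpc' hcm' b b' hb hb' hlink
    have hmp := hm.lt_of_isStart hp' hpp
    obtain ⟨hc'l, hb'e⟩ := List.getElem?_eq_some_iff.1 hb'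
    obtain ⟨hcl, hbe⟩ := List.getElem?_eq_some_iff.1 hb
    have hM : slice l c p' = b :: (slice l c p').tail := by
      have hlt : c < (l.take p').length := by rw [List.length_take]; lia
      rw [slice, List.drop_eq_getElem_cons hlt, List.getElem_take, hbe, List.tail_cons]
    have hL : l.drop c' = b' :: l.drop (c' + 1) := by
      rw [List.drop_eq_getElem_cons hc'l, hb'e]
    have hl : l = l.take p ++ slice l p c ++ b :: (slice l c p').tail ++ slice l p' c' ++
        b' :: l.drop (c' + 1) := by
      rw [← hM, take_append_slice l hpc, take_append_slice l (by lia),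
        take_append_slice l hpc', ← hL, List.take_append_drop]
    have hX : Disjoint (S ∩ {u | u ∈ slice l p' c'}) ({u | u ∈ l} ∪ H)ᶜ := by
      rw [Set.disjoint_compl_right_iff_subset]
      rintro x ⟨-, hx⟩
      obtain ⟨d, -, -, hd⟩ := mem_slice.1 hx
      exact Or.inl (List.mem_of_getElem? hd)
    have hmod := indepNumOn_modular (G := G) (K := S \ ({u | u ∈ l} ∪ H))
      (A := S ∩ {u | u ∈ slice l p c}) (B := S ∩ {u | u ∈ slice l p' c'})
      (fun x hx => hx.2) hX (by
        rintro x ⟨-, hx⟩ y ⟨-, hy⟩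
        obtain ⟨d, h1, h2, hd⟩ := mem_slice.1 hx
        obtain ⟨d', h1', h2', hd'⟩ := mem_slice.1 hy
        refine ⟨?_, ih (d + d') (by lia) d d' rfl h1 (by lia) h1' (by lia) x y hd hd'⟩
        rintro rfl
        have := (List.getElem?_inj (List.getElem?_eq_some_iff.1 hd).1 hs.nodup).1 (hd.trans hd'.symm)
        lia)
    have hmono : ∀ {i j k : ℕ}, j ≤ k → S ∩ {u | u ∈ slice l i j} ⊆
        S ∩ {u | u ∈ slice l i k} := by
      rintro i j k hjk x ⟨hx, hx'⟩
      obtain ⟨d, h1, h2, hd⟩ := mem_slice.1 hx'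
      exact ⟨hx, mem_slice.2 ⟨d, h1, by lia, hd⟩⟩
    have h1 := (indepNumOn_mono (G := G) (Set.union_subset_union_right
      (S \ ({u | u ∈ l} ∪ H)) (hmono (i := p) hcm))).trans hm.indepNumOn_le
    have h2 := (indepNumOn_mono (G := G) (Set.union_subset_union_right
      (S \ ({u | u ∈ l} ∪ H)) (hmono (i := p') hcm'))).trans hm'.indepNumOn_le
    have h3 := hs.lt_of_cross hl hp.getLast?_take (by
        rw [← hM]
        intro y hy
        rw [slice, List.getLast?_drop] at hy
        split_ifs at hy
        · simp at hy
        · exact hp'.getLast?_take y hy) (by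
        intro y hy
        obtain ⟨d, h1, h2, hd⟩ := mem_slice.1 hy
        exact hm.not_adj d h1 (by lia) y hd) (by
        intro y hy
        obtain ⟨d, h1, h2, hd⟩ := mem_slice.1 hy
        exact hm'.not_adj d h1 (by lia) y hd) hlink
    lia

open Classical in
theorem IsStuck.add_ncard_lt [Finite V] (hs : IsStuck G S l H) :
    indepNumOn G (S \ {u | u ∈ l}) + {y | y ∈ l ∧ ∃ h ∈ H, G.Adj h y}.ncard + 1 ≤
      indepNumOn G S := by
  set F₀ : Finset ℕ := {q ∈ Finset.range l.length | ∃ y, l[q]? = some y ∧ ∃ h ∈ H, G.Adj h y}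
    with hF₀
  set F : Finset ℕ := insert 0 (F₀.image (· + 1)) with hF
  have hcard : F.card = F₀.card + 1 := by
    rw [hF, Finset.card_insert_of_notMem (by simp),
      Finset.card_image_of_injective _ (add_left_injective 1)]
  have hF₀card : {y | y ∈ l ∧ ∃ h ∈ H, G.Adj h y}.ncard ≤ F₀.card := by
    rw [← Set.ncard_coe_finset]
    refine Set.ncard_le_ncard_of_injOn (l.idxOf ·) ?_ ?_
    · rintro y ⟨hy, hy'⟩
      have := List.idxOf_lt_length_iff.2 hy
      simp only [hF₀, Finset.coe_filter, Finset.mem_range, Set.mem_ofPred_eq]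
      exact ⟨this, y, by simp [List.getElem?_eq_getElem this], hy'⟩
    · rintro x ⟨hx, -⟩ y ⟨hy, -⟩ hxy
      exact (List.idxOf_inj hx).1 hxy
  have hstart : ∀ p ∈ F, IsStart G l H p := by
    intro p hp
    simp only [hF, hF₀, Finset.mem_insert, Finset.mem_image, Finset.mem_filter] at hp
    obtain rfl | ⟨q, ⟨-, hq⟩, rfl⟩ := hp
    · exact Or.inl rfl
    · exact Or.inr ⟨q, rfl, hq⟩
  choose! m hm using fun p (hp : p ∈ F) => hs.exists_isStop (hstart p hp)
  have hmain := indepNumOn_biUnion_of_not_linked (G := G) (X := ({u | u ∈ l} ∪ H)ᶜ)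
    (K := S \ ({u | u ∈ l} ∪ H)) (U := fun p => S ∩ {u | u ∈ slice l p (m p + 1)})
    (fun x hx => hx.2) F (by
      intro p hp
      rw [Set.disjoint_compl_right_iff_subset]
      rintro x ⟨-, hx⟩
      obtain ⟨d, -, -, hd⟩ := mem_slice.1 hx
      exact Or.inl (List.mem_of_getElem? hd)) (by
      rintro p hp p' hp' hpp x ⟨-, hx⟩ y ⟨-, hy⟩
      obtain ⟨d, h1, h2, hd⟩ := mem_slice.1 hx
      obtain ⟨d', h1', h2', hd'⟩ := mem_slice.1 hy
      refine ⟨?_, hs.not_linked (hstart p hp) (hstart p' hp') (hm p hp) (hm p' hp') hpp _ d d' rfl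
        h1 (by lia) h1' (by lia) x y hd hd'⟩
      rintro rfl
      have := (List.getElem?_inj (List.getElem?_eq_some_iff.1 hd).1 hs.nodup).1 (hd.trans hd'.symm)
      have := (hm p hp).lt_of_isStart (hstart p' hp') hpp
      lia) (fun p hp => (hm p hp).lt_indepNumOn)
  have hunion := indepNumOn_union (G := G) (A := S ∩ H)
    (B := S \ ({u | u ∈ l} ∪ H) ∪ ⋃ p ∈ F, S ∩ {u | u ∈ slice l p (m p + 1)}) (by
      rintro a ⟨-, ha⟩ b (⟨-, hb⟩ | hb)
      · rw [Set.mem_union, not_or] at hb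
        exact ⟨fun e => hb.2 (e ▸ ha), fun h => hb.2 (hs.closed a ha b h hb.1)⟩
      · simp only [Set.mem_iUnion] at hb
        obtain ⟨p, hp, -, hb⟩ := hb
        obtain ⟨d, h1, h2, hd⟩ := mem_slice.1 hb
        refine ⟨fun e => hs.notMem a ha (e ▸ List.mem_of_getElem? hd), fun h => ?_⟩
        exact (hm p hp).not_adj d h1 (by lia) b hd ⟨a, ha, h⟩)
  have hle : indepNumOn G (S ∩ H ∪ (S \ ({u | u ∈ l} ∪ H) ∪
      ⋃ p ∈ F, S ∩ {u | u ∈ slice l p (m p + 1)})) ≤ indepNumOn G S := by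
    refine indepNumOn_mono (Set.union_subset Set.inter_subset_left
      (Set.union_subset Set.sdiff_subset ?_))
    exact Set.iUnion₂_subset fun _ _ => Set.inter_subset_left
  have hD : indepNumOn G (S \ {u | u ∈ l}) ≤
      indepNumOn G (S \ ({u | u ∈ l} ∪ H)) + indepNumOn G (S ∩ H) := by
    refine (indepNumOn_mono ?_).trans (indepNumOn_union_le _ _)
    rintro x ⟨hx, hxl⟩
    by_cases hxH : x ∈ H
    · exact Or.inr ⟨hx, hxH⟩
    · exact Or.inl ⟨hx, fun h => h.elim hxl hxH⟩
  lia

theorem IsStuck.exists_mem_not_adj [Finite V] (hs : IsStuck G S l H) :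
    ∃ s ∈ S, s ∈ l ∧ ¬ ∃ h ∈ H, G.Adj h s := by
  obtain ⟨m, hm⟩ := hs.exists_isStop (p := 0) (Or.inl rfl)
  by_contra! hcon
  refine absurd hm.lt_indepNumOn (not_lt.2 (indepNumOn_mono ?_))
  refine Set.union_subset subset_rfl ?_
  rintro x ⟨hx, hx'⟩
  obtain ⟨d, h1, h2, hd⟩ := mem_slice.1 hx'
  exact absurd (hcon x hx (List.mem_of_getElem? hd)) (hm.not_adj d h1 (by lia) x hd)

end Stops

section Kouider

variable {G : SimpleGraph V} {S H : Set V} {l : List V}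

theorem exists_mem_support_adj (hcl : ∀ h ∈ H, ∀ w, G.Adj h w → w ∉ l → w ∈ H)
    (hd : ∀ h ∈ H, h ∉ l) {v s : V} (p : G.Walk v s) (hv : v ∈ H) (hs : s ∈ l) :
    ∃ y ∈ p.support, y ∈ l ∧ ∃ h ∈ H, G.Adj h y := by
  induction p with
  | nil => exact absurd hs (hd _ hv)
  | @cons u w s huw p ih =>
    by_cases hw : w ∈ l
    · exact ⟨w, by simp, hw, u, hv, huw⟩
    · obtain ⟨y, hy, h⟩ := ih (hcl u hv w huw hw) hs
      exact ⟨y, by simp [hy], h⟩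

theorem localConn_le_ncard (hcl : ∀ h ∈ H, ∀ w, G.Adj h w → w ∉ l → w ∈ H)
    (hd : ∀ h ∈ H, h ∉ l) {v s : V} (hv : v ∈ H) (hs : s ∈ l) (hsH : ¬ ∃ h ∈ H, G.Adj h s) :
    localConn G v s ≤ {y | y ∈ l ∧ ∃ h ∈ H, G.Adj h y}.ncard := by
  refine csSup_le' ?_
  rintro _ ⟨P, hP, rfl⟩
  choose y hyp hyl using fun p : G.Path v s => exists_mem_support_adj hcl hd p.1 hv hs
  have hfin : {y | y ∈ l ∧ ∃ h ∈ H, G.Adj h y}.Finite :=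
    l.finite_toSet.subset fun y hy => hy.1
  refine Set.ncard_le_ncard_of_injOn y (fun p _ => hyl p) ?_ hfin
  intro p hp q hq hpq
  by_contra hne
  rcases hP hp hq hne (y p) (hyp p) (hpq ▸ hyp q) with h | h
  · exact hd v hv (h ▸ (hyl p).1)
  · exact hsH (h ▸ (hyl p).2)

/-- The vertices reachable from `v` while avoiding `l`. -/
def avoidingComponent (G : SimpleGraph V) (l : List V) (v : V) : Set V :=
  {w | Relation.ReflTransGen (fun u w => G.Adj u w ∧ w ∉ l) v w}

theorem notMem_of_mem_avoidingComponent {v w : V} (hv : v ∉ l)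
    (hw : w ∈ avoidingComponent G l v) : w ∉ l := by
  rcases Relation.ReflTransGen.cases_tail hw with rfl | ⟨u, -, -, h⟩
  · exact hv
  · exact h

theorem exists_walk_avoidingComponent {v w : V} (hw : w ∈ avoidingComponent G l v) :
    ∃ p : G.Walk v w, ∀ u ∈ p.support, u ∈ avoidingComponent G l v := by
  refine exists_walk_of_reflTransGen (X := avoidingComponent G l v) .refl ?_
  have hw' : Relation.ReflTransGen (fun u w => G.Adj u w ∧ w ∉ l) v w := hw
  induction hw' with
  | refl => exact .refl
  | tail h1 h2 ih => exact (ih h1).tail ⟨h2.1, h1.tail h2⟩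

theorem isStuck_avoidingComponent [Finite V] (hc : l.IsChain G.Adj) (hn : l.Nodup) {v : V}
    (hv : v ∈ S) (hvl : v ∉ l)
    (hcover : ∀ l' : List V, l'.IsChain G.Adj → l'.Nodup → ¬ S ⊆ {u | u ∈ l'})
    (hmin : ∀ (l' : List V) (v' : V), l'.IsChain G.Adj → l'.Nodup → v' ∈ S → v' ∉ l' →
      indepNumOn G (S \ {u | u ∈ l}) ≤ indepNumOn G (S \ {u | u ∈ l'}) ∧
        (indepNumOn G (S \ {u | u ∈ l'}) = indepNumOn G (S \ {u | u ∈ l}) →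
          (avoidingComponent G l v).ncard ≤ (avoidingComponent G l' v').ncard)) :
    IsStuck G S l (avoidingComponent G l v) := by
  set H := avoidingComponent G l v with hH
  have hvH : v ∈ H := .refl
  have hd : ∀ h ∈ H, h ∉ l := fun h hh => notMem_of_mem_avoidingComponent hvl hh
  have hcl : ∀ h ∈ H, ∀ w, G.Adj h w → w ∉ l → w ∈ H := fun h hh w hw hwl =>
    Relation.ReflTransGen.tail hh ⟨hw, hwl⟩
  refine ⟨hc, hn, hd, hcl, ?_, ⟨v, hvH⟩, ?_⟩
  · intro a ha b hb
    obtain ⟨p, hp⟩ := exists_walk_avoidingComponent ha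
    obtain ⟨q, hq⟩ := exists_walk_avoidingComponent hb
    refine ⟨p.reverse.append q, fun u hu => ?_⟩
    rw [Walk.mem_support_append_iff, Walk.support_reverse, List.mem_reverse] at hu
    exact hu.elim (hp u) (hq u)
  · rintro l' hc' hn' ⟨h, hhH, hhl'⟩ hdrop
    by_contra! hle
    have hsplit : indepNumOn G (S \ {u | u ∈ l}) =
        indepNumOn G (S \ ({u | u ∈ l} ∪ H)) + indepNumOn G (S ∩ H) := by
      rw [← indepNumOn_union]
      · congr 1
        ext x
        have := hd x
        simp only [Set.mem_sdiff, Set.mem_union, Set.mem_inter_iff, Set.mem_ofPred_eq]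
        tauto
      · rintro a ⟨-, ha⟩ b ⟨-, hb⟩
        rw [Set.mem_union, not_or] at ha
        exact ⟨fun e => ha.2 (e ▸ hb), fun hab => ha.2 (hcl b hb a hab.symm ha.1)⟩
    have hsplit' : indepNumOn G (S \ {u | u ∈ l'}) ≤
        indepNumOn G ((S \ {u | u ∈ l'}) \ H) + indepNumOn G ((S \ {u | u ∈ l'}) ∩ H) := by
      conv_lhs => rw [← Set.sdiff_union_inter (S \ {u | u ∈ l'}) H]
      exact indepNumOn_union_le _ _
    rcases ((S \ {u | u ∈ l'}) ∩ H).eq_empty_or_nonempty with hemp | ⟨v', ⟨hv'S, hv'l⟩, hv'H⟩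
    · obtain ⟨v', hv'S, hv'l⟩ := Set.not_subset.1 (hcover l' hc' hn')
      have h1 := (hmin l' v' hc' hn' hv'S hv'l).1
      have h2 := indepNumOn_pos (G := G) (A := S ∩ H) ⟨v, hv, hvH⟩
      have h3 : S \ {u | u ∈ l'} = (S \ {u | u ∈ l'}) \ H := by
        rw [eq_comm, sdiff_eq_left, Set.disjoint_iff_inter_eq_empty, hemp]
      rw [h3] at h1
      lia
    · have h1 := hmin l' v' hc' hn' hv'S hv'l
      have h2 : indepNumOn G ((S \ {u | u ∈ l'}) ∩ H) ≤ indepNumOn G (S ∩ H) :=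
        indepNumOn_mono (Set.inter_subset_inter_left _ Set.sdiff_subset)
      have hsub : avoidingComponent G l' v' ⊆ H := by
        intro w hw
        have hw' : Relation.ReflTransGen (fun u w => G.Adj u w ∧ w ∉ l') v' w := hw
        induction hw' with
        | refl => exact hv'H
        | @tail u w h1 h2 ih =>
          by_cases hwl : w ∈ l
          · exact absurd ⟨u, ih h1, h2.1⟩ (hdrop w hwl h2.2)
          · exact hcl u (ih h1) w h2.1 hwl
      have hlt : (avoidingComponent G l' v').ncard < H.ncard := by
        refine Set.ncard_lt_ncard ⟨hsub, fun hHs => ?_⟩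
        exact notMem_of_mem_avoidingComponent hv'l (hHs hhH) hhl'
      have := h1.2 (by lia)
      lia

/-- Some path covers `S` or lowers the independence number of `S` by more than the
connectivity of `S`. -/
theorem exists_path_cover_or_indepNumOn_lt [Finite V] {κ : ℕ}
    (hκ : ∀ x ∈ S, ∀ y ∈ S, x ≠ y → κ ≤ localConn G x y) :
    ∃ l : List V, l.IsChain G.Adj ∧ l.Nodup ∧ (S ⊆ {u | u ∈ l} ∨
      indepNumOn G (S \ {u | u ∈ l}) + κ + 1 ≤ indepNumOn G S) := by
  by_cases hcover : ∃ l : List V, l.IsChain G.Adj ∧ l.Nodup ∧ S ⊆ {u | u ∈ l}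
  · obtain ⟨l, hc, hn, hl⟩ := hcover
    exact ⟨l, hc, hn, Or.inl hl⟩
  push Not at hcover
  obtain ⟨v₀, hv₀, -⟩ := Set.not_subset.1 (hcover [] .nil .nil)
  obtain ⟨⟨l, v⟩, ⟨hc, hn, hv, hvl⟩, hmin⟩ := WellFounded.has_min
    (InvImage.wf (fun x : List V × V => toLex (indepNumOn G (S \ {u | u ∈ x.1}),
      (avoidingComponent G x.1 x.2).ncard)) wellFounded_lt)
    {x | x.1.IsChain G.Adj ∧ x.1.Nodup ∧ x.2 ∈ S ∧ x.2 ∉ x.1}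
    ⟨([], v₀), .nil, .nil, hv₀, by simp⟩
  have hstuck := isStuck_avoidingComponent hc hn hv hvl hcover (by
    intro l' v' hc' hn' hv' hvl'
    have := hmin (l', v') ⟨hc', hn', hv', hvl'⟩
    rw [InvImage, Prod.Lex.toLex_lt_toLex] at this
    dsimp only at this
    lia)
  obtain ⟨s, hsS, hsl, hs⟩ := hstuck.exists_mem_not_adj
  have h1 := hκ v hv s hsS (fun e => hvl (e ▸ hsl))
  have h2 := localConn_le_ncard hstuck.closed hstuck.notMem .refl hsl hs
  have h3 := hstuck.add_ncard_lt
  exact ⟨l, hc, hn, Or.inr (by lia)⟩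

theorem natCast_le_localConn {κ : ℕ} (hκ : (κ : ℕ∞) ≤ setConn G S) {x y : V} (hx : x ∈ S)
    (hy : y ∈ S) (hxy : x ≠ y) : κ ≤ localConn G x y := by
  have : setConn G S ≤ localConn G x y :=
    (iInf₂_le x hx).trans ((iInf₂_le y hy).trans (iInf_le _ hxy))
  exact_mod_cast hκ.trans this

theorem exists_natCast_le_setConn {k a : ℕ} (h : (a : ℕ∞) + 1 ≤ k + setConn G S) :
    ∃ κ : ℕ, (κ : ℕ∞) ≤ setConn G S ∧ a + 1 ≤ k + κ := by
  rcases eq_or_ne (setConn G S) ⊤ with htop | htop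
  · exact ⟨a + 1, htop ▸ le_top, by lia⟩
  · lift setConn G S to ℕ using htop with κ
    exact ⟨κ, le_rfl, by exact_mod_cast h⟩

end Kouider

/-- If `G` is connected, `k ≥ 2` and `α_G(S) ≤ k + κ_G(S) - 1`, then `G` has a
tree with at most `k` leaves covering `S`. -/
theorem stmt_0 [Fintype V] (G : SimpleGraph V) (hG : G.Connected)
    (k : ℕ) (hk : 2 ≤ k) (S : Set V)
    (hακ : (indepNumOn G S : ℕ∞) + 1 ≤ (k : ℕ∞) + setConn G S) :
    ∃ T : G.Subgraph, T.coe.IsTree ∧ S ⊆ T.verts ∧ (subLeaves T).ncard ≤ k := by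
  obtain ⟨κ, hκ, hk'⟩ := exists_natCast_le_setConn hακ
  obtain ⟨l, hne, hc, hn, hl⟩ : ∃ l : List V, l ≠ [] ∧ l.IsChain G.Adj ∧ l.Nodup ∧
      indepNumOn G (S \ {u | u ∈ l}) + 2 ≤ k := by
    obtain ⟨l, hc, hn, hl⟩ := exists_path_cover_or_indepNumOn_lt
      fun x hx y hy => natCast_le_localConn hκ hx hy
    have hle : indepNumOn G (S \ {u | u ∈ l}) + 2 ≤ k := by
      rcases hl with hl | hl
      · have : indepNumOn G (S \ {u | u ∈ l}) = 0 := by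
          obtain ⟨I, hI, -, hIc⟩ := exists_maxIndepOn G (S \ {u | u ∈ l})
          rw [Set.sdiff_eq_empty.2 hl, Set.subset_empty_iff] at hI
          rw [← hIc, hI, Set.ncard_empty]
        lia
      · lia
    rcases eq_or_ne l [] with rfl | hne
    · obtain ⟨x⟩ := hG.nonempty
      refine ⟨[x], by simp, by simp, by simp, le_trans ?_ hle⟩
      exact Nat.add_le_add_right (indepNumOn_mono (Set.sdiff_subset_sdiff_right (by simp))) 2
    · exact ⟨l, hne, hc, hn, hle⟩
  obtain ⟨T, hT, -, hverts, hends⟩ := exists_isSubtree_of_isChain hne hc hn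
  obtain ⟨T', hT', hS, hends'⟩ := hT.exists_cover hG S
  refine ⟨T', hT'.isTree, hS, ?_⟩
  have : (subLeaves T').ncard ≤ (subEnds T').ncard :=
    Set.ncard_le_ncard fun v hv => ⟨hv.1, hv.2.le⟩
  rw [hverts] at hends'
  lia
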